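/- arXiv:1109.2823 — 6 statements merged into one kernel-verified Lean document; each statement's English description precedes it below -/
import Mathlib

section
/- Let X be a first countable, locally compact, paracompact Hausdorff topological space and let f : X → X be a topologically Anosov homeomorphism. Then there exists a family {R_λ} of pairwise disjoint, closed, f-invariant subsets of X such that Ω(f) = ⋃_λ R_λ and the restriction of f to each R_λ is topologically transitive. Moreover, if X is compact, then this family is finite. -/
open Set Topology

namespace TopAnosovPaper

variable {X Y : Type*}

section Defs

variable [TopologicalSpace X]

/-- The `n`-th iterate (n ∈ ℤ) of a homeomorphism, as a function. -/
def iter (f : X ≃ₜ X) (n : ℤ) : X → X := ⇑(f.toEquiv ^ n)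

/-- `N` is an expansive neighborhood for `f`: a closed neighborhood of the
diagonal such that any two distinct points are eventually separated by `F = f × f`. -/
def IsExpansiveNbhd (f : X ≃ₜ X) (N : Set (X × X)) : Prop :=
  IsClosed N ∧ N ∈ nhdsSet (Set.diagonal X) ∧
    ∀ x y : X, x ≠ y → ∃ n : ℤ, (iter f n x, iter f n y) ∉ N

/-- `f` is topologically expansive. -/
def TopExpansive (f : X ≃ₜ X) : Prop := ∃ N : Set (X × X), IsExpansiveNbhd f N

/-- A `D`-pseudo-orbit: a bi-infinite sequence with `(f x_{i-1}, x_i) ∈ D`. -/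
def IsPseudoOrbit (f : X ≃ₜ X) (D : Set (X × X)) (x : ℤ → X) : Prop :=
  ∀ i : ℤ, (f (x (i - 1)), x i) ∈ D

/-- `y` `E`-traces the bi-infinite sequence `x`. -/
def Traces (f : X ≃ₜ X) (E : Set (X × X)) (y : X) (x : ℤ → X) : Prop :=
  ∀ i : ℤ, (iter f i y, x i) ∈ E

/-- `f` has the topological shadowing property. -/
def TopShadowing (f : X ≃ₜ X) : Prop :=
  ∀ E ∈ nhdsSet (Set.diagonal X), ∃ D ∈ nhdsSet (Set.diagonal X),
    ∀ x : ℤ → X, IsPseudoOrbit f D x → ∃ y : X, Traces f E y x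

/-- `f` is topologically Anosov: expansive with the shadowing property. -/
def TopAnosov (f : X ≃ₜ X) : Prop := TopExpansive f ∧ TopShadowing f

/-- An `A`-chain from `x` to `y` (of length `n ≥ 1`). -/
def IsChainFromTo (f : X ≃ₜ X) (A : Set (X × X)) (x y : X) : Prop :=
  ∃ n : ℕ, 1 ≤ n ∧ ∃ c : ℕ → X, c 0 = x ∧ c n = y ∧
    ∀ i : ℕ, 1 ≤ i → i ≤ n → (f (c (i - 1)), c i) ∈ A

/-- `x ∼ y`: for every neighborhood `A` of the diagonal there is an `A`-chain
from `x` to `y` and one from `y` to `x`. -/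
def ChainRel (f : X ≃ₜ X) (x y : X) : Prop :=
  ∀ A ∈ nhdsSet (Set.diagonal X), IsChainFromTo f A x y ∧ IsChainFromTo f A y x

/-- The chain recurrent set. -/
def CR (f : X ≃ₜ X) : Set X := {x | ChainRel f x x}

/-- `R` is a chain component: an equivalence class of `∼` restricted to `CR f`. -/
def IsChainComponent (f : X ≃ₜ X) (R : Set X) : Prop :=
  ∃ x ∈ CR f, R = {y | y ∈ CR f ∧ ChainRel f x y}

/-- The non-wandering set of `f`. -/
def NonWandering (f : X ≃ₜ X) : Set X :=
  {x | ∀ G : Set X, IsOpen G → x ∈ G → ∃ n : ℕ, 0 < n ∧ (iter f n '' G ∩ G).Nonempty}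

/-- `x` is a periodic point of `f`. -/
def Periodic (f : X ≃ₜ X) (x : X) : Prop := ∃ n : ℕ, 0 < n ∧ iter f n x = x

/-- The set of periodic points of `f`. -/
def Per (f : X ≃ₜ X) : Set X := {x | Periodic f x}

/-- A relation `M ⊆ X × X` is proper if `M[S]` is compact for every compact `S`. -/
def IsProperRel (M : Set (X × X)) : Prop :=
  ∀ S : Set X, IsCompact S → IsCompact {y : X | ∃ x ∈ S, (x, y) ∈ M}

/-- A set `U ⊆ X × X` is wide if `U ∪ (S × X) = X × X` for some compact `S`. -/
def IsWide (U : Set (X × X)) : Prop :=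
  ∃ S : Set X, IsCompact S ∧ U ∪ (S ×ˢ (Set.univ : Set X)) = Set.univ

/-- `E` is symmetric. -/
def SymmRel (E : Set (X × X)) : Prop := ∀ p : X × X, p ∈ E → (p.2, p.1) ∈ E

/-- `E² = {(x,y) : ∃ z, (x,z) ∈ E ∧ (z,y) ∈ E}`. -/
def sq (E : Set (X × X)) : Set (X × X) := {p : X × X | ∃ z : X, (p.1, z) ∈ E ∧ (z, p.2) ∈ E}

/-- The local stable set of `x` relative to `B`. -/
def WsLoc (f : X ≃ₜ X) (B : Set (X × X)) (x : X) : Set X :=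
  {y | ∀ i : ℤ, 0 ≤ i → (iter f i x, iter f i y) ∈ B}

/-- The local unstable set of `x` relative to `B`. -/
def WuLoc (f : X ≃ₜ X) (B : Set (X × X)) (x : X) : Set X :=
  {y | ∀ i : ℤ, i ≤ 0 → (iter f i x, iter f i y) ∈ B}

/-- The stable set of `x`. -/
def Ws (f : X ≃ₜ X) (x : X) : Set X :=
  {y | ∀ B ∈ nhdsSet (Set.diagonal X), ∃ n : ℕ, ∀ i : ℤ, (n : ℤ) ≤ i →
    (iter f i x, iter f i y) ∈ B}

/-- The unstable set of `x`. -/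
def Wu (f : X ≃ₜ X) (x : X) : Set X :=
  {y | ∀ B ∈ nhdsSet (Set.diagonal X), ∃ n : ℕ, ∀ i : ℤ, i ≤ -(n : ℤ) →
    (iter f i x, iter f i y) ∈ B}

/-- `f` restricted to `R` is topologically transitive: for any nonempty
relatively open subsets `G, H` of `R` there is `n ∈ ℕ` with `f^n(G) ∩ H ≠ ∅`. -/
def TransitiveOn (f : X ≃ₜ X) (R : Set X) : Prop :=
  ∀ G H : Set X, (∃ U : Set X, IsOpen U ∧ G = U ∩ R) → (∃ V : Set X, IsOpen V ∧ H = V ∩ R) →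
    G.Nonempty → H.Nonempty → ∃ n : ℕ, (iter f n '' G ∩ H).Nonempty

/-- `V_N(A)`: pairs whose first `N` forward and backward iterates all lie in `A`. -/
def VN (f : X ≃ₜ X) (A : Set (X × X)) (N : ℕ) : Set (X × X) :=
  {p : X × X | ∀ n : ℤ, |n| ≤ (N : ℤ) → (iter f n p.1, iter f n p.2) ∈ A}

/-- The `n`-th power (n ∈ ℕ) of a homeomorphism. -/
def hpowNat (f : X ≃ₜ X) : ℕ → X ≃ₜ X
  | 0 => Homeomorph.refl X
  | n + 1 => (hpowNat f n).trans f

/-- The `k`-th power (k ∈ ℤ) of a homeomorphism, as a homeomorphism. -/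
def hpow (f : X ≃ₜ X) : ℤ → X ≃ₜ X
  | Int.ofNat n => hpowNat f n
  | Int.negSucc n => (hpowNat f (n + 1)).symm

end Defs

end TopAnosovPaper

open TopAnosovPaper

namespace TopAnosovPaper

open Filter Relation

section Chains

variable {X : Type*}

lemma exists_chain_of_transGen {r : X → X → Prop} {a b : X} (h : TransGen r a b) :
    ∃ n : ℕ, 0 < n ∧ ∃ c : ℕ → X, c 0 = a ∧ c n = b ∧ ∀ i < n, r (c i) (c (i + 1)) := by
  induction h with
  | @single b h =>
    refine ⟨1, one_pos, fun i => if i = 0 then a else b, by simp, by simp, fun i hi => ?_⟩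
    obtain rfl : i = 0 := by lia
    simpa using h
  | @tail b d _ h ih =>
    obtain ⟨n, hn, c, h0, hcn, hc⟩ := ih
    refine ⟨n + 1, by lia, fun i => if i ≤ n then c i else d, by simp [h0], by simp,
      fun i hi => ?_⟩
    rcases Nat.lt_succ_iff_lt_or_eq.1 hi with hi | rfl
    · simpa [hi.le, Nat.succ_le_of_lt hi] using hc i hi
    · simpa [hcn] using h

lemma exists_closed_chain {r : X → X → Prop} {a b : X} (h : TransGen r a b)
    (h' : TransGen r b a) :
    ∃ n k : ℕ, k < n ∧ ∃ c : ℕ → X, c 0 = a ∧ c k = b ∧ c n = a ∧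
      ∀ i < n, r (c i) (c (i + 1)) := by
  obtain ⟨k, hk, c, h0, hck, hc⟩ := exists_chain_of_transGen h
  obtain ⟨m, hm, d, d0, hdm, hd⟩ := exists_chain_of_transGen h'
  refine ⟨k + m, k, by lia, fun i => if i ≤ k then c i else d (i - k), by simp [h0],
    by simp [hck], by simp [hm.ne', hdm], fun i hi => ?_⟩
  rcases lt_trichotomy i k with hik | rfl | hik
  · simpa [hik.le, Nat.succ_le_of_lt hik] using hc i hik
  · simpa [hck, d0] using hd 0 hm
  · have := hd (i - k) (by lia)
    rw [show i - k + 1 = i + 1 - k by lia] at this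
    simpa [show ¬ i ≤ k by lia, show ¬ i + 1 ≤ k by lia] using this

end Chains

section Aux

variable {X : Type*} [TopologicalSpace X]

lemma iter_zero (f : X ≃ₜ X) (x : X) : iter f 0 x = x := by simp [iter]

lemma iter_one (f : X ≃ₜ X) (x : X) : iter f 1 x = f x := by simp [iter]

lemma iter_add (f : X ≃ₜ X) (a b : ℤ) (x : X) :
    iter f (a + b) x = iter f a (iter f b x) := by
  simp [iter, zpow_add, Equiv.Perm.mul_apply]

lemma iter_succ (f : X ≃ₜ X) (a : ℤ) (x : X) : iter f (a + 1) x = f (iter f a x) := by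
  rw [add_comm, iter_add, iter_one]

lemma continuous_iter (f : X ≃ₜ X) (n : ℤ) : Continuous (iter f n) := by
  have hneg : iter f (-1) = f.symm := by
    funext x
    simp [iter]
  induction n using Int.induction_on with
  | zero => exact continuous_id.congr fun x => (iter_zero f x).symm
  | succ k ih => exact (f.continuous.comp ih).congr fun x => (iter_succ f k x).symm
  | pred k ih =>
    refine (f.symm.continuous.comp ih).congr fun x => ?_
    rw [sub_eq_add_neg, add_comm, iter_add, hneg]
    rfl

lemma iter_add_mul_period {f : X ≃ₜ X} {x : X} {n : ℤ} (h : iter f n x = x) (m k : ℤ) :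
    iter f (m + k * n) x = iter f m x := by
  have key : iter f (k * n) x = x := by
    unfold iter at h ⊢
    rw [mul_comm, zpow_mul]
    exact Function.IsFixedPt.perm_zpow h k
  rw [iter_add, key]

lemma Periodic.iter {f : X ≃ₜ X} {x : X} (h : Periodic f x) (k : ℤ) :
    Periodic f (iter f k x) := by
  obtain ⟨n, hn, h⟩ := h
  exact ⟨n, hn, by rw [← iter_add, add_comm, iter_add, h]⟩

/-- One step of an `A`-chain. -/
def Step (f : X ≃ₜ X) (A : Set (X × X)) (a b : X) : Prop := (f a, b) ∈ A

/-- Every neighborhood `A` of the diagonal admits an `A`-chain from `a` to `b`. -/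
def ChainTo (f : X ≃ₜ X) (a b : X) : Prop :=
  ∀ A ∈ nhdsSet (diagonal X), TransGen (Step f A) a b

/-- The periodic points chain equivalent to `p`. -/
def periodicClass (f : X ≃ₜ X) (p : X) : Set X :=
  {q | Periodic f q ∧ ChainTo f p q ∧ ChainTo f q p}

lemma ChainTo.trans {f : X ≃ₜ X} {a b c : X} (h : ChainTo f a b) (h' : ChainTo f b c) :
    ChainTo f a c := fun A hA => (h A hA).trans (h' A hA)

lemma diag_mem {A : Set (X × X)} (hA : A ∈ nhdsSet (diagonal X)) (x : X) : (x, x) ∈ A :=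
  subset_of_mem_nhdsSet hA (mem_diagonal x)

lemma reflTransGen_iter (f : X ≃ₜ X) {A : Set (X × X)} (hA : A ∈ nhdsSet (diagonal X))
    (x : X) {a b : ℤ} (hab : a ≤ b) : ReflTransGen (Step f A) (iter f a x) (iter f b x) := by
  induction b, hab using Int.leInduction with
  | base => exact .refl
  | succ b _ ih =>
    refine ih.tail ?_
    unfold Step
    rw [iter_succ]
    exact diag_mem hA _

lemma transGen_of_step_last (f : X ≃ₜ X) {A : Set (X × X)} (hA : A ∈ nhdsSet (diagonal X))
    (x : X) {y : X} {a b : ℤ} (hab : a < b) (h : (iter f b x, y) ∈ A) :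
    TransGen (Step f A) (iter f a x) y := by
  refine .tail' (reflTransGen_iter f hA x (b := b - 1) (by lia)) ?_
  unfold Step
  rwa [← iter_succ, sub_add_cancel]

lemma Periodic.chainTo_iter {f : X ≃ₜ X} {x : X} (h : Periodic f x) (a b : ℤ) :
    ChainTo f (TopAnosovPaper.iter f a x) (TopAnosovPaper.iter f b x) := by
  obtain ⟨n, hn, h⟩ := h
  intro A hA
  rw [← iter_add_mul_period h b (|a - b| + 1)]
  refine transGen_of_step_last f hA x ?_ (diag_mem hA _)
  have h1 := le_abs_self (a - b)
  have : |a - b| + 1 ≤ (|a - b| + 1) * (n : ℤ) :=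
    le_mul_of_one_le_right (by positivity) (by exact_mod_cast hn)
  lia

lemma iter_mem_periodicClass {f : X ≃ₜ X} {p q : X} (h : q ∈ periodicClass f p) (k : ℤ) :
    iter f k q ∈ periodicClass f p := by
  obtain ⟨hq, h1, h2⟩ := h
  have h3 := hq.chainTo_iter 0 k
  have h4 := hq.chainTo_iter k 0
  rw [iter_zero] at h3 h4
  exact ⟨hq.iter k, h1.trans h3, h4.trans h2⟩

lemma mem_periodicClass_self {f : X ≃ₜ X} {p : X} (h : Periodic f p) :
    p ∈ periodicClass f p := by
  have := h.chainTo_iter 0 0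
  rw [iter_zero] at this
  exact ⟨h, this, this⟩

lemma periodicClass_eq {f : X ≃ₜ X} {p q : X} (h : q ∈ periodicClass f p) :
    periodicClass f p = periodicClass f q := by
  obtain ⟨-, h1, h2⟩ := h
  ext r
  exact ⟨fun ⟨hr, h3, h4⟩ => ⟨hr, h2.trans h3, h4.trans h1⟩,
    fun ⟨hr, h3, h4⟩ => ⟨hr, h1.trans h3, h4.trans h2⟩⟩

lemma image_periodicClass (f : X ≃ₜ X) (p : X) : f '' periodicClass f p = periodicClass f p := by
  ext q
  constructor
  · rintro ⟨r, hr, rfl⟩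
    rw [← iter_one]
    exact iter_mem_periodicClass hr 1
  · intro hq
    refine ⟨iter f (-1) q, iter_mem_periodicClass hq _, ?_⟩
    rw [← iter_succ, neg_add_cancel, iter_zero]

/-- A neighborhood `E` of the diagonal such that two points `E`-close to a common point form a
pair in `N`, and the points `E`-close to a given point lie in a compact set. -/
structure IsTracingNbhd (N E : Set (X × X)) : Prop where
  mem : E ∈ nhdsSet (diagonal X)
  pair : ∀ {y y' z}, (y, z) ∈ E → (y', z) ∈ E → (y, y') ∈ N
  fibre : ∀ z, ∃ K : Set X, IsCompact K ∧ ∀ y, (y, z) ∈ E → y ∈ K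

lemma exists_isTracingNbhd [LocallyCompactSpace X] [ParacompactSpace X] [T2Space X]
    {N : Set (X × X)} (hN : N ∈ nhdsSet (diagonal X)) : ∃ E, IsTracingNbhd N E := by
  have hloc : ∀ x : X, ∃ U : Set X, IsOpen U ∧ x ∈ U ∧ U ×ˢ U ⊆ N ∧
      ∃ K, IsCompact K ∧ U ⊆ K := by
    intro x
    have hx : N ∈ 𝓝 (x, x) := mem_nhdsSet_iff_forall.1 hN _ (mem_diagonal x)
    rw [nhds_prod_eq, mem_prod_same_iff] at hx
    obtain ⟨t, ht, htN⟩ := hx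
    obtain ⟨K, hK, hxK⟩ := exists_compact_mem_nhds x
    obtain ⟨U, hU, hUo, hxU⟩ := mem_nhds_iff.1 (inter_mem ht hxK)
    exact ⟨U, hUo, hxU, (prod_mono (fun _ h => (hU h).1) (fun _ h => (hU h).1)).trans htN,
      K, hK, fun _ h => (hU h).2⟩
  choose U hUo hxU hUN K hK hUK using hloc
  obtain ⟨V, hVo, hVcov, hVfin, hVU⟩ := precise_refinement U hUo
    (iUnion_eq_univ_iff.2 fun x => ⟨x, hxU x⟩)
  obtain ⟨F, hFcov, hFc, hFV⟩ := exists_iUnion_eq_closed_subset hVo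
    (fun x => hVfin.point_finite x) hVcov
  have hFfin : LocallyFinite F := hVfin.subset hFV
  refine ⟨{p | ∀ i, p.2 ∈ F i → p.1 ∈ V i}, ?_, ?_, ?_⟩
  · refine mem_nhdsSet_iff_forall.2 ?_
    rintro ⟨x, x'⟩ (rfl : x = x')
    have h1 : ∀ᶠ y in 𝓝 x, ∀ i ∈ {i | x ∈ F i}, y ∈ V i :=
      (eventually_all_finite (hFfin.point_finite x)).2
        fun i hi => (hVo i).mem_nhds (hFV i hi)
    have h2 := hFfin.eventually_subset hFc x
    rw [nhds_prod_eq]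
    filter_upwards [h1.prod_mk h2] with p hp i hi
    exact hp.1 i (hp.2 hi)
  · intro y y' z h h'
    obtain ⟨i, hi⟩ := iUnion_eq_univ_iff.1 hFcov z
    exact hUN i ⟨hVU i (h i hi), hVU i (h' i hi)⟩
  · intro z
    obtain ⟨i, hi⟩ := iUnion_eq_univ_iff.1 hFcov z
    exact ⟨K i, hK i, fun y hy => hUK i (hVU i (hy i hi))⟩

/-- For `F ⊆ G` with `F` closed and `G` open, the pairs whose first coordinate lies in `G`
whenever the second lies in `F` form a neighborhood of the diagonal. -/
lemma nbhd_of_closed_subset_open {F G : Set X} (hF : IsClosed F) (hG : IsOpen G) (h : F ⊆ G) :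
    {p : X × X | p.2 ∈ F → p.1 ∈ G} ∈ nhdsSet (diagonal X) := by
  have heq : {p : X × X | p.2 ∈ F → p.1 ∈ G} = Prod.snd ⁻¹' Fᶜ ∪ Prod.fst ⁻¹' G := by
    ext p
    simp [imp_iff_not_or]
  rw [heq]
  refine IsOpen.mem_nhdsSet ((hF.isOpen_compl.preimage continuous_snd).union
    (hG.preimage continuous_fst)) |>.2 ?_
  rintro ⟨x, x'⟩ (rfl : x = x')
  by_cases hx : x ∈ F
  · exact .inr (h hx)
  · exact .inl hx

/-- Closed pseudo-orbits are traced by periodic points. -/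
lemma exists_periodic_tracing {f : X ≃ₜ X} {N E : Set (X × X)} (hN : IsExpansiveNbhd f N)
    (hE : IsTracingNbhd N E) (hf : TopShadowing f) {B : Set (X × X)}
    (hB : B ∈ nhdsSet (diagonal X)) :
    ∃ D ∈ nhdsSet (diagonal X), ∀ a b, TransGen (Step f D) a b → TransGen (Step f D) b a →
      ∃ z, Periodic f z ∧ (z, a) ∈ B ∧ ∃ k : ℕ, (iter f k z, b) ∈ B := by
  obtain ⟨D, hD, hshadow⟩ := hf (E ∩ B) (inter_mem hE.mem hB)
  refine ⟨D, hD, fun a b hab hba => ?_⟩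
  obtain ⟨n, k, hkn, c, h0, hk, hn, hc⟩ := exists_closed_chain hab hba
  have hnpos : (0 : ℤ) < n := by lia
  obtain ⟨z, hz⟩ := hshadow (fun i : ℤ => c (i % n).toNat) (by
    intro i
    obtain ⟨m, hm⟩ := Int.eq_ofNat_of_zero_le (Int.emod_nonneg (i - 1) hnpos.ne')
    have hmn : m < n := by
      have := Int.emod_lt_of_pos (i - 1) hnpos
      lia
    have hstep := hc m hmn
    have hi : i % n = (m + 1 : ℤ) % n := by
      have : i % n = ((i - 1) % n + 1) % n := by simp
      rw [this, hm]
    simp only [hm, hi]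
    rcases Nat.lt_or_ge (m + 1) n with h | h
    · rw [Int.emod_eq_of_lt (by lia) (by lia)]
      exact hstep
    · have hmn' : m + 1 = n := by lia
      have hz : ((m : ℤ) + 1) % n = 0 := by
        rw [← hmn']
        simp
      rw [hmn'] at hstep
      rw [hz]
      unfold Step at hstep
      simpa [h0, hn] using hstep)
  have hper : iter f n z = z := by
    by_contra hne
    obtain ⟨i, hi⟩ := hN.2.2 _ _ hne
    refine hi (hE.pair (z := c (i % n).toNat) ?_ (hz i).1)
    have := (hz (i + n)).1
    simpa only [iter_add, Int.add_emod_right] using this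
  refine ⟨z, ⟨n, by lia, hper⟩, ?_, k, ?_⟩
  · have := (hz 0).2
    simpa [iter_zero, h0] using this
  · have := (hz k).2
    have hmod : (k : ℤ) % n = k := Int.emod_eq_of_lt (by lia) (by lia)
    simpa [hmod, hk] using this

/-- A point whose orbit stays close to a periodic orbit along times `s j` accumulates on it. -/
lemma mapClusterPt_of_asymptotic [T2Space X] {f : X ≃ₜ X} {N : Set (X × X)}
    (hN : IsExpansiveNbhd f N) {w q : X} {K : Set X} (hK : IsCompact K) (s : ℕ → ℤ)
    (hsK : ∀ᶠ j in atTop, iter f (s j) w ∈ K)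
    (hs : ∀ m : ℤ, ∀ᶠ j in atTop, (iter f (m + s j) w, iter f m q) ∈ N) :
    MapClusterPt q atTop fun j => iter f (s j) w := by
  obtain ⟨w', -, hw'⟩ := hK.exists_mapClusterPt_of_frequently hsK.frequently
  suffices w' = q by rwa [← this]
  by_contra hne
  obtain ⟨m, hm⟩ := hN.2.2 _ _ hne
  refine hm ?_
  have hcl : IsClosed {x | (iter f m x, iter f m q) ∈ N} :=
    hN.1.preimage ((continuous_iter f m).prodMk continuous_const)
  by_contra hout
  have hfr := (mapClusterPt_iff_frequently.1 hw') _ (hcl.isOpen_compl.mem_nhds hout)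
  obtain ⟨j, hj, hjN⟩ := (hfr.and_eventually (hs m)).exists
  rw [iter_add] at hjN
  exact hj hjN

/-- Nearby periodic points are linked by chains. -/
lemma exists_chainTo_nhds [T2Space X] {f : X ≃ₜ X} {N E : Set (X × X)}
    (hN : IsExpansiveNbhd f N) (hE : IsTracingNbhd N E) (hf : TopShadowing f) (x : X) :
    ∃ U, IsOpen U ∧ x ∈ U ∧
      ∀ p ∈ U, ∀ q ∈ U, Periodic f p → Periodic f q → ChainTo f p q := by
  obtain ⟨D, hD, hshadow⟩ := hf E hE.mem
  have hx : D ∈ 𝓝 (x, x) := mem_nhdsSet_iff_forall.1 hD _ (mem_diagonal x)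
  rw [nhds_prod_eq, mem_prod_same_iff] at hx
  obtain ⟨t, ht, htD⟩ := hx
  obtain ⟨U, hUt, hUo, hxU⟩ := mem_nhds_iff.1 ht
  refine ⟨U, hUo, hxU, fun p hp q hq ⟨n, hn, hpn⟩ ⟨m, hm, hqm⟩ => ?_⟩
  obtain ⟨w, hw⟩ := hshadow (fun i : ℤ => if i < 0 then iter f i p else iter f i q) (by
    intro i
    rcases lt_trichotomy i 0 with hi | rfl | hi
    · simp only [hi, show i - 1 < 0 by lia, if_true, ← iter_succ, sub_add_cancel]
      exact diag_mem hD _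
    · simp only [show (0 : ℤ) - 1 < 0 by lia, if_true, ← iter_succ, sub_add_cancel, lt_irrefl,
        if_false, iter_zero]
      exact htD ⟨hUt hp, hUt hq⟩
    · simp only [show ¬ i < 0 by lia, show ¬ i - 1 < 0 by lia, if_false, ← iter_succ,
        sub_add_cancel]
      exact diag_mem hD _)
  have hwp : ∀ i < 0, (iter f i w, iter f i p) ∈ E := fun i hi => by
    simpa [hi] using hw i
  have hwq : ∀ i, 0 ≤ i → (iter f i w, iter f i q) ∈ E := fun i hi => by
    simpa [not_lt.2 hi] using hw i
  have hEN : ∀ {y z}, (y, z) ∈ E → (y, z) ∈ N := fun h => hE.pair h (diag_mem hE.mem _)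
  have hn1 : (1 : ℤ) ≤ n := by exact_mod_cast hn
  have hm1 : (1 : ℤ) ≤ m := by exact_mod_cast hm
  have hclq : MapClusterPt q atTop fun j : ℕ => iter f ((j : ℤ) * m) w := by
    obtain ⟨K, hK, hKq⟩ := hE.fibre q
    refine mapClusterPt_of_asymptotic hN hK _ (.of_forall fun j => hKq _ ?_) fun i => ?_
    · have := hwq (0 + (j : ℤ) * m) (by positivity)
      rwa [iter_add_mul_period hqm, iter_zero, zero_add] at this
    · filter_upwards [eventually_ge_atTop i.natAbs] with j hj
      have := hwq (i + (j : ℤ) * m) (by nlinarith [abs_le.1 (show |i| ≤ j by rw [Int.abs_eq_natAbs]; exact_mod_cast hj)])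
      rw [iter_add_mul_period hqm] at this
      exact hEN this
  have hclp : MapClusterPt p atTop fun j : ℕ => iter f (-(j : ℤ) * n) w := by
    obtain ⟨K, hK, hKp⟩ := hE.fibre p
    refine mapClusterPt_of_asymptotic hN hK _ ?_ fun i => ?_
    · filter_upwards [eventually_gt_atTop 0] with j hj
      have := hwp (0 + -(j : ℤ) * n) (by nlinarith)
      rw [iter_add_mul_period hpn, iter_zero, zero_add] at this
      exact hKp _ this
    · filter_upwards [eventually_gt_atTop i.natAbs] with j hj
      have := hwp (i + -(j : ℤ) * n) (by nlinarith [abs_lt.1 (show |i| < j by rw [Int.abs_eq_natAbs]; exact_mod_cast hj)])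
      rw [iter_add_mul_period hpn] at this
      exact hEN this
  intro A hA
  have hAp : ∀ᶠ y in 𝓝 p, (p, y) ∈ A :=
    (continuous_const.prodMk continuous_id).tendsto p
      (mem_nhdsSet_iff_forall.1 hA (p, p) (mem_diagonal p))
  have hAq : ∀ᶠ y in 𝓝 q, (y, q) ∈ A :=
    (continuous_id.prodMk continuous_const).tendsto q
      (mem_nhdsSet_iff_forall.1 hA (q, q) (mem_diagonal q))
  obtain ⟨j, hj⟩ := (hclp.frequently hAp).exists
  obtain ⟨k, hk, hk0⟩ := ((hclq.frequently hAq).and_eventually (eventually_gt_atTop 0)).exists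
  have h1 : TransGen (Step f A) p (iter f (-(j : ℤ) * n) w) := by
    have := transGen_of_step_last f hA p (a := 0) (b := n) (by lia)
      (y := iter f (-(j : ℤ) * n) w) (by rwa [hpn])
    rwa [iter_zero] at this
  exact h1.trans (transGen_of_step_last f hA w (by nlinarith) hk)

/-- Periodic points are dense in the non-wandering set. -/
lemma nonWandering_subset_closure_per [RegularSpace X] {f : X ≃ₜ X} {N E : Set (X × X)}
    (hN : IsExpansiveNbhd f N) (hE : IsTracingNbhd N E) (hf : TopShadowing f) :
    NonWandering f ⊆ closure (Per f) := by
  intro x hx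
  refine mem_closure_iff.2 fun G hG hxG => ?_
  obtain ⟨F, hF, hFc, hFG⟩ := exists_mem_nhds_isClosed_subset (hG.mem_nhds hxG)
  obtain ⟨D, hD, hper⟩ := exists_periodic_tracing hN hE hf
    (nbhd_of_closed_subset_open hFc hG hFG)
  have hxD : D ∈ 𝓝 (x, x) := mem_nhdsSet_iff_forall.1 hD _ (mem_diagonal x)
  rw [nhds_prod_eq, mem_prod_same_iff] at hxD
  obtain ⟨t, ht, htD⟩ := hxD
  obtain ⟨U, hU, hUo, hxU⟩ := mem_nhds_iff.1 (inter_mem ht hF)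
  obtain ⟨n, hn, y, ⟨z, hz, rfl⟩, hy⟩ := hx U hUo hxU
  have hloop := transGen_of_step_last f hD z (a := 0) (b := n) (y := z) (by lia)
    (htD ⟨(hU hy).1, (hU hz).1⟩)
  rw [iter_zero] at hloop
  obtain ⟨p, hp, hpz, -⟩ := hper z z hloop hloop
  exact ⟨p, hpz (hU hz).2, hp⟩

lemma closure_per_subset_nonWandering (f : X ≃ₜ X) : closure (Per f) ⊆ NonWandering f := by
  intro x hx G hG hxG
  obtain ⟨p, hpG, n, hn, hp⟩ := mem_closure_iff.1 hx G hG hxG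
  exact ⟨n, hn, p, ⟨p, hpG, hp⟩, hpG⟩

lemma transitiveOn_closure_periodicClass [T2Space X] {f : X ≃ₜ X} {N E : Set (X × X)}
    (hN : IsExpansiveNbhd f N) (hE : IsTracingNbhd N E) (hf : TopShadowing f) (p : X) :
    TransitiveOn f (closure (periodicClass f p)) := by
  rintro _ _ ⟨U, hU, rfl⟩ ⟨V, hV, rfl⟩ ⟨x, hxU, hx⟩ ⟨y, hyV, hy⟩
  obtain ⟨a, haU, ha⟩ := mem_closure_iff.1 hx U hU hxU
  obtain ⟨b, hbV, hb⟩ := mem_closure_iff.1 hy V hV hyV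
  obtain ⟨O, hO, haO, hchain⟩ := exists_chainTo_nhds hN hE hf a
  obtain ⟨D, hD, hper⟩ := exists_periodic_tracing hN hE hf (inter_mem
    (nbhd_of_closed_subset_open isClosed_singleton (hU.inter hO)
      (singleton_subset_iff.2 ⟨haU, haO⟩))
    (nbhd_of_closed_subset_open isClosed_singleton hV (singleton_subset_iff.2 hbV)))
  obtain ⟨z, hz, hza, k, hkb⟩ := hper a b ((ha.2.2.trans hb.2.1) D hD)
    ((hb.2.2.trans ha.2.1) D hD)
  obtain ⟨hzU, hzO⟩ := hza.1 rfl
  have hzp : z ∈ periodicClass f p :=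
    ⟨hz, ha.2.1.trans (hchain a haO z hzO ha.1 hz), (hchain z hzO a haO hz ha.1).trans ha.2.2⟩
  exact ⟨k, iter f k z, ⟨z, ⟨hzU, subset_closure hzp⟩, rfl⟩, hkb.2 rfl,
    subset_closure (iter_mem_periodicClass hzp k)⟩

end Aux

end TopAnosovPaper

/-- Spectral decomposition for topologically Anosov homeomorphisms. -/
theorem spectral_decomposition {X : Type*} [TopologicalSpace X]
    [FirstCountableTopology X] [LocallyCompactSpace X] [ParacompactSpace X] [T2Space X]
    (f : X ≃ₜ X) (hf : TopAnosov f) :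
    ∃ 𝒞 : Set (Set X),
      (𝒞.Pairwise fun R S => Disjoint R S) ∧
      (∀ R ∈ 𝒞, IsClosed R) ∧
      (∀ R ∈ 𝒞, ⇑f '' R = R) ∧
      (∀ R ∈ 𝒞, TransitiveOn f R) ∧
      NonWandering f = ⋃₀ 𝒞 ∧
      (CompactSpace X → 𝒞.Finite) := by
  obtain ⟨⟨N, hN⟩, hsh⟩ := hf
  obtain ⟨E, hE⟩ := exists_isTracingNbhd hN.2.1
  have hloc := exists_chainTo_nhds hN hE hsh
  have hmeet : ∀ x, ∃ U, IsOpen U ∧ x ∈ U ∧ ∀ p q, (closure (periodicClass f p) ∩ U).Nonempty →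
      (closure (periodicClass f q) ∩ U).Nonempty → periodicClass f p = periodicClass f q := by
    intro x
    obtain ⟨U, hU, hxU, hchain⟩ := hloc x
    refine ⟨U, hU, hxU, fun p q ⟨y, hy, hyU⟩ ⟨z, hz, hzU⟩ => ?_⟩
    obtain ⟨a, haU, ha⟩ := mem_closure_iff.1 hy U hU hyU
    obtain ⟨b, hbU, hb⟩ := mem_closure_iff.1 hz U hU hzU
    rw [periodicClass_eq ha, periodicClass_eq hb]
    exact periodicClass_eq ⟨hb.1, hchain a haU b hbU ha.1 hb.1, hchain b hbU a haU hb.1 ha.1⟩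
  refine ⟨(fun p => closure (periodicClass f p)) '' Per f, ?_, ?_, ?_, ?_, ?_, ?_⟩
  · rintro _ ⟨p, -, rfl⟩ _ ⟨q, -, rfl⟩ hne
    refine disjoint_left.2 fun x hxp hxq => hne ?_
    obtain ⟨U, -, hxU, h⟩ := hmeet x
    exact congrArg closure (h p q ⟨x, hxp, hxU⟩ ⟨x, hxq, hxU⟩)
  · rintro _ ⟨p, -, rfl⟩
    exact isClosed_closure
  · rintro _ ⟨p, -, rfl⟩
    dsimp only
    rw [f.image_closure, image_periodicClass]
  · rintro _ ⟨p, -, rfl⟩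
    exact transitiveOn_closure_periodicClass hN hE hsh p
  · refine Subset.antisymm (fun x hx => ?_) ?_
    · have hx' := nonWandering_subset_closure_per hN hE hsh hx
      obtain ⟨U, hU, hxU, hchain⟩ := hloc x
      obtain ⟨p, hpU, hp⟩ := mem_closure_iff.1 hx' U hU hxU
      refine ⟨_, ⟨p, hp, rfl⟩, mem_closure_iff.2 fun V hV hxV => ?_⟩
      obtain ⟨q, ⟨hqV, hqU⟩, hq⟩ := mem_closure_iff.1 hx' (V ∩ U) (hV.inter hU) ⟨hxV, hxU⟩
      exact ⟨q, hqV, hq, hchain p hpU q hqU hp hq, hchain q hqU p hpU hq hp⟩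
    · rintro x ⟨_, ⟨p, -, rfl⟩, hx⟩
      exact closure_per_subset_nonWandering f (closure_mono (fun q hq => hq.1) hx)
  · intro _
    have hfin : LocallyFinite fun R : (fun p => closure (periodicClass f p)) '' Per f =>
        (R : Set X) := by
      intro x
      obtain ⟨U, hU, hxU, h⟩ := hmeet x
      refine ⟨U, hU.mem_nhds hxU, Set.Subsingleton.finite ?_⟩
      intro R hR S hS
      obtain ⟨p, -, hp⟩ := R.2
      obtain ⟨q, -, hq⟩ := S.2
      refine Subtype.ext (hp.symm.trans ((congrArg closure (h p q ?_ ?_)).trans hq))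
      · exact (show closure (periodicClass f p) = R from hp) ▸ hR
      · exact (show closure (periodicClass f q) = S from hq) ▸ hS
    refine Set.finite_univ_iff.1 (hfin.finite_of_compact ?_)
    rintro ⟨_, p, hp, rfl⟩
    exact ⟨p, subset_closure (mem_periodicClass_self hp)⟩
end

section
/- Let X be a first countable, locally compact, paracompact Hausdorff topological space and let f : X → X be a topologically expansive homeomorphism. Then f has a proper expansive neighborhood, i.e., an expansive neighborhood A such that for every compact S ⊆ X the set A[S] = {y ∈ X : ∃ x ∈ S, (x,y) ∈ A} is compact. -/
open Set Topology

open TopAnosovPaper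

/-- If `C` is a locally finite family of compact sets, then `N ∩ ⋃ i, C i ×ˢ C i` is a proper
relation as soon as it is closed. -/
theorem isProperRel_inter_iUnion_prod {X ι : Type*} [TopologicalSpace X] {N : Set (X × X)}
    {C : ι → Set X} (hN : IsClosed (N ∩ ⋃ i, C i ×ˢ C i)) (hlf : LocallyFinite C)
    (hC : ∀ i, IsCompact (C i)) : IsProperRel (N ∩ ⋃ i, C i ×ˢ C i) := by
  intro S hS
  have hfin : {i | (C i ∩ S).Nonempty}.Finite := hlf.finite_nonempty_inter_compact hS
  have hK : IsCompact (⋃ i ∈ {i | (C i ∩ S).Nonempty}, C i) :=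
    hfin.isCompact_biUnion fun i _ => hC i
  convert ((hS.prod hK).inter_right hN).image continuous_snd using 1
  ext y
  constructor
  · rintro ⟨x, hx, hxy⟩
    obtain ⟨i, hxi, hyi⟩ := mem_iUnion.1 hxy.2
    exact ⟨(x, y), ⟨⟨hx, mem_biUnion (show i ∈ {i | (C i ∩ S).Nonempty} from ⟨x, hxi, hx⟩) hyi⟩,
      hxy⟩, rfl⟩
  · rintro ⟨⟨x, z⟩, ⟨⟨hx, _⟩, hxy⟩, rfl⟩
    exact ⟨x, hx, hxy⟩

/-- A locally compact paracompact Hausdorff space has a locally finite open cover by relatively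
compact sets. -/
theorem exists_locallyFinite_open_cover_isCompact_closure (X : Type*) [TopologicalSpace X]
    [LocallyCompactSpace X] [ParacompactSpace X] [T2Space X] :
    ∃ u : X → Set X, (∀ i, IsOpen (u i)) ∧ ⋃ i, u i = univ ∧ LocallyFinite u ∧
      ∀ i, IsCompact (closure (u i)) := by
  choose K hK hKx using fun x : X => exists_compact_mem_nhds x
  obtain ⟨u, huo, hucov, hulf, huK⟩ := precise_refinement (fun x => interior (K x))
    (fun _ => isOpen_interior)
    (iUnion_eq_univ_iff.2 fun x => ⟨x, mem_interior_iff_mem_nhds.2 (hKx x)⟩)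
  exact ⟨u, huo, hucov, hulf, fun i =>
    (hK i).closure_of_subset ((huK i).trans interior_subset)⟩

/-- A topologically expansive homeomorphism has a proper expansive
neighborhood. -/
theorem exists_proper_expansive_nbhd {X : Type*} [TopologicalSpace X]
    [FirstCountableTopology X] [LocallyCompactSpace X] [ParacompactSpace X] [T2Space X]
    (f : X ≃ₜ X) (hf : TopExpansive f) :
    ∃ A : Set (X × X), IsExpansiveNbhd f A ∧ IsProperRel A := by
  obtain ⟨N, hNc, hNn, hNe⟩ := hf
  obtain ⟨u, huo, hucov, hulf, huc⟩ := exists_locallyFinite_open_cover_isCompact_closure X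
  have hclosed : IsClosed (N ∩ ⋃ i, closure (u i) ×ˢ closure (u i)) := by
    refine hNc.inter (LocallyFinite.isClosed_iUnion ?_ fun i =>
      isClosed_closure.prod isClosed_closure)
    exact (hulf.closure.preimage_continuous continuous_fst).subset fun i p hp => hp.1
  refine ⟨_, ⟨hclosed, Filter.inter_mem hNn ?_, fun x y hxy => ?_⟩,
    isProperRel_inter_iUnion_prod hclosed hulf.closure huc⟩
  · refine mem_nhdsSet_iff_forall.2 fun p hp => ?_
    obtain ⟨i, hi⟩ := iUnion_eq_univ_iff.1 hucov p.1
    have hmem : p ∈ u i ×ˢ u i := ⟨hi, mem_diagonal_iff.1 hp ▸ hi⟩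
    exact Filter.mem_of_superset (((huo i).prod (huo i)).mem_nhds hmem)
      ((prod_mono subset_closure subset_closure).trans
        (subset_iUnion (fun i => closure (u i) ×ˢ closure (u i)) i))
  · obtain ⟨n, hn⟩ := hNe x y hxy
    exact ⟨n, fun h => hn h.1⟩
end

section
/- Let X be a topological space and f : X → X a homeomorphism. Then f has the topological shadowing property if and only if f^k has the topological shadowing property for every nonzero integer k. -/
open Set Topology

open TopAnosovPaper

namespace TopAnosovPaper

variable {X : Type*} [TopologicalSpace X]

theorem hpowNat_toEquiv (f : X ≃ₜ X) (n : ℕ) : (hpowNat f n).toEquiv = f.toEquiv ^ n := by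
  induction n with
  | zero => rfl
  | succ n ih =>
    rw [pow_succ', ← ih]
    rfl

theorem hpowNat_apply (f : X ≃ₜ X) (n : ℕ) (x : X) : hpowNat f n x = (f.toEquiv ^ n) x := by
  rw [← hpowNat_toEquiv]
  rfl

theorem iter_hpowNat (f : X ≃ₜ X) (n : ℕ) (i : ℤ) : iter (hpowNat f n) i = iter f (n * i) := by
  unfold iter
  rw [hpowNat_toEquiv, zpow_mul, zpow_natCast]

theorem iter_symm (f : X ≃ₜ X) (i : ℤ) : iter f.symm i = iter f (-i) := by
  unfold iter
  rw [zpow_neg, ← inv_zpow]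
  rfl

theorem mk_self_mem_of_mem_nhdsSet_diagonal {D : Set (X × X)} (hD : D ∈ nhdsSet (diagonal X))
    (x : X) : (x, x) ∈ D :=
  subset_of_mem_nhdsSet hD (mem_diagonal x)

theorem TopShadowing.symm {f : X ≃ₜ X} (hf : TopShadowing f) : TopShadowing f.symm := by
  intro E hE
  obtain ⟨D, hD, hshadow⟩ := hf E hE
  let g : X × X → X × X := fun p => (f p.2, f p.1)
  have hg : Continuous g := by fun_prop
  have hmaps : MapsTo g (diagonal X) (diagonal X) := by
    rintro ⟨x, y⟩ hxy
    exact congrArg f (Eq.symm hxy)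
  refine ⟨g ⁻¹' D, hg.tendsto_nhdsSet hmaps hD, fun x hx => ?_⟩
  obtain ⟨y, hy⟩ := hshadow (fun i => x (-i)) fun i => by
    have h : (f (x (1 - i)), f (f.symm (x (1 - i - 1)))) ∈ D := hx (1 - i)
    rw [f.apply_symm_apply] at h
    convert h using 4 <;> ring
  refine ⟨y, fun i => ?_⟩
  rw [iter_symm]
  simpa using hy (-i)

theorem TopShadowing.hpowNat {f : X ≃ₜ X} (hf : TopShadowing f) {n : ℕ} (hn : n ≠ 0) :
    TopShadowing (hpowNat f n) := by
  intro E hE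
  obtain ⟨D, hD, hshadow⟩ := hf E hE
  have hpos : (0 : ℤ) < n := by positivity
  refine ⟨D, hD, fun x hx => ?_⟩
  let z : ℤ → X := fun m => iter f (m % n) (x (m / n))
  have hz (i j : ℤ) (hj : 0 ≤ j) (hjn : j < n) : z (n * i + j) = iter f j (x i) := by
    simp only [z, Int.mul_add_emod_self_left, Int.emod_eq_of_lt hj hjn,
      Int.mul_add_ediv_left _ _ hpos.ne', Int.ediv_eq_zero_of_lt hj hjn, add_zero]
  have hstep (j : ℤ) (w : X) : f (iter f (j - 1) w) = iter f j w := by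
    change (f.toEquiv * f.toEquiv ^ (j - 1)) w = (f.toEquiv ^ j) w
    rw [mul_self_zpow, sub_add_cancel]
  obtain ⟨y, hy⟩ := hshadow z fun m => by
    obtain ⟨i, j, hj, hjn, rfl⟩ : ∃ i j : ℤ, 0 ≤ j ∧ j < n ∧ m = n * i + j :=
      ⟨m / n, m % n, Int.emod_nonneg _ hpos.ne', Int.emod_lt_of_pos _ hpos,
        (Int.mul_ediv_add_emod m n).symm⟩
    rcases hj.eq_or_lt with rfl | hj'
    · have h := hx i
      rw [hpowNat_apply, ← zpow_natCast] at h
      rw [show n * i + 0 - 1 = n * (i - 1) + ((n : ℤ) - 1) by ring,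
        hz _ _ (by lia) (by lia), hz _ _ le_rfl hpos, hstep]
      exact h
    · rw [add_sub_assoc, hz _ _ (by lia) (by lia), hz _ _ hj hjn, hstep]
      exact mk_self_mem_of_mem_nhdsSet_diagonal hD _
  refine ⟨y, fun i => ?_⟩
  have h := hy (n * i + 0)
  rw [hz _ _ le_rfl hpos, add_zero] at h
  rw [iter_hpowNat]
  exact h

end TopAnosovPaper

/-- `f` has the topological shadowing property iff `f^k` does, for every
nonzero `k ∈ ℤ`. -/
theorem topShadowing_iff_zpow {X : Type*} [TopologicalSpace X] (f : X ≃ₜ X) :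
    TopShadowing f ↔ ∀ k : ℤ, k ≠ 0 → TopShadowing (hpow f k) := by
  refine ⟨fun hf k hk => ?_, fun h => h 1 one_ne_zero⟩
  cases k with
  | ofNat n => exact hf.hpowNat (by simpa using hk)
  | negSucc n => exact (hf.hpowNat n.succ_ne_zero).symm
end

section
/- Let X be a first countable, locally compact, paracompact Hausdorff topological space and let f : X → X be a topologically Anosov homeomorphism. If E is a neighborhood of Δ_X such that E² is an expansive neighborhood for f, then there is a neighborhood D of Δ_X such that every D-pseudo-orbit is E-traced by exactly one point of X; moreover, if a D-pseudo-orbit (x_i) is periodic (i.e., x_{i+n} = x_i for all i, for some n ≥ 1), then the point that E-traces it is a periodic point of f. -/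
open Set Topology

open TopAnosovPaper

/-- The symmetric part of a neighborhood of the diagonal is a neighborhood of the diagonal. -/
theorem inter_preimage_swap_mem_nhdsSet_diagonal {X : Type*} [TopologicalSpace X]
    {E : Set (X × X)} (hE : E ∈ nhdsSet (Set.diagonal X)) :
    E ∩ Prod.swap ⁻¹' E ∈ nhdsSet (Set.diagonal X) := by
  refine Filter.inter_mem hE ?_
  have h : Filter.Tendsto Prod.swap (nhdsSet (Set.diagonal X)) (nhdsSet (Set.diagonal X)) :=
    continuous_swap.tendsto_nhdsSet fun _ hp => hp.symm
  exact h hE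

/-- Unique shadowing; periodic pseudo-orbits are traced by periodic points. -/
theorem unique_shadowing {X : Type*} [TopologicalSpace X]
    [FirstCountableTopology X] [LocallyCompactSpace X] [ParacompactSpace X] [T2Space X]
    (f : X ≃ₜ X) (hf : TopAnosov f)
    (E : Set (X × X)) (hE : E ∈ nhdsSet (Set.diagonal X))
    (hE2 : IsExpansiveNbhd f (sq E)) :
    ∃ D ∈ nhdsSet (Set.diagonal X),
      (∀ x : ℤ → X, IsPseudoOrbit f D x → ∃! y : X, Traces f E y x) ∧
      (∀ (x : ℤ → X) (n : ℤ), IsPseudoOrbit f D x → 1 ≤ n → (∀ i : ℤ, x (i + n) = x i) →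
        ∀ y : X, Traces f E y x → Periodic f y) := by
  obtain ⟨D, hD, hshadow⟩ := hf.2 _ (inter_preimage_swap_mem_nhdsSet_diagonal hE)
  have huniq : ∀ x y z, Traces f E y x → Traces f (E ∩ Prod.swap ⁻¹' E) z x → y = z := by
    intro x y z hy hz
    by_contra hne
    obtain ⟨n, hn⟩ := hE2.2.2 y z hne
    exact hn ⟨x n, hy n, (hz n).2⟩
  refine ⟨D, hD, fun x hx => ?_, fun x n hx hn hper y hy => ?_⟩
  · obtain ⟨z, hz⟩ := hshadow x hx
    exact ⟨z, fun i => (hz i).1, fun y hy => huniq x y z hy hz⟩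
  · obtain ⟨z, hz⟩ := hshadow x hx
    have hshift : Traces f E (iter f n y) x := by
      intro i
      have h := hy (i + n)
      rwa [hper, iter, zpow_add] at h
    refine ⟨n.toNat, by omega, ?_⟩
    rw [Int.toNat_of_nonneg (by omega), huniq x _ z hshift hz, huniq x y z hy hz]
end

section
/- Let X and Y be first countable, locally compact, paracompact Hausdorff topological spaces and let f : X → Y be a function. If for every wide neighborhood U of Δ_Y there exists a neighborhood V of Δ_X such that (f × f)(V) ⊆ U, then f is continuous. -/
open Set Topology

open TopAnosovPaper

/-- Continuity Lemma. -/
theorem continuity_lemma {X Y : Type*}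
    [TopologicalSpace X] [FirstCountableTopology X] [LocallyCompactSpace X]
    [ParacompactSpace X] [T2Space X]
    [TopologicalSpace Y] [FirstCountableTopology Y] [LocallyCompactSpace Y]
    [ParacompactSpace Y] [T2Space Y]
    (f : X → Y)
    (h : ∀ U : Set (Y × Y), IsWide U → U ∈ nhdsSet (Set.diagonal Y) →
      ∃ V ∈ nhdsSet (Set.diagonal X), ∀ p : X × X, p ∈ V → (f p.1, f p.2) ∈ U) :
    Continuous f := by
  refine continuous_iff_continuousAt.2 fun x => ?_
  intro W hW
  obtain ⟨O, hOW, hO, hxO⟩ := mem_nhds_iff.1 hW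
  have hU : IsOpen {p : Y × Y | p.1 ≠ f x ∨ p.2 ∈ O} :=
    (isOpen_compl_singleton.preimage continuous_fst).union (hO.preimage continuous_snd)
  obtain ⟨V, hV, hVU⟩ := h {p : Y × Y | p.1 ≠ f x ∨ p.2 ∈ O}
    ⟨{f x}, isCompact_singleton, by
      ext p
      by_cases hp : p.1 = f x <;> simp [hp]⟩
    (hU.mem_nhdsSet.2 (by
      rintro ⟨a, b⟩ hab
      obtain rfl : a = b := hab
      by_cases ha : a = f x
      · exact Or.inr (ha ▸ hxO)
      · exact Or.inl ha))
  have hVx : V ∈ 𝓝 (x, x) := nhds_le_nhdsSet (Set.mem_diagonal x) hV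
  have hslice : ∀ᶠ z in 𝓝 x, (x, z) ∈ V :=
    (Continuous.prodMk_right x).continuousAt.preimage_mem_nhds hVx
  rw [Filter.mem_map]
  filter_upwards [hslice] with z hz
  exact hOW ((hVU _ hz).resolve_left fun hne => hne rfl)
end

section
/- Let X be a topological space, f, g : X → X homeomorphisms, and B a symmetric subset of X × X such that B² is an expansive neighborhood for f. If h, h' : X → X are maps satisfying (h(x), x) ∈ B and (h'(x), x) ∈ B for all x ∈ X, f ∘ h = h ∘ g, and f ∘ h' = h' ∘ g, then h = h'. -/
open Set Topology

open TopAnosovPaper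

/-- A map semiconjugating two permutations semiconjugates their integer powers. -/
theorem Function.Semiconj.perm_zpow {α β : Type*} {h : α → β} {σ : Equiv.Perm α}
    {τ : Equiv.Perm β} (hc : Function.Semiconj h σ τ) (n : ℤ) :
    Function.Semiconj h (σ ^ n : Equiv.Perm α) (τ ^ n : Equiv.Perm β) := by
  have hc_inv : Function.Semiconj h (σ⁻¹ : Equiv.Perm α) (τ⁻¹ : Equiv.Perm β) :=
    hc.inverses_right σ.apply_symm_apply τ.symm_apply_apply
  induction n with
  | zero => exact fun _ => rfl
  | succ n ih =>
    rw [zpow_add_one, zpow_add_one]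
    exact ih.comp_right hc
  | pred n ih =>
    rw [zpow_sub_one, zpow_sub_one]
    exact ih.comp_right hc_inv

theorem iter_apply_of_semiconj {X : Type*} [TopologicalSpace X] {f g : X ≃ₜ X} {h : X → X}
    (hc : ∀ x : X, f (h x) = h (g x)) (n : ℤ) (x : X) : iter f n (h x) = h (iter g n x) :=
  have hsemi : Function.Semiconj h g.toEquiv f.toEquiv := fun y => (hc y).symm
  (hsemi.perm_zpow n x).symm

/-- Uniqueness of the semiconjugacy when `B` is symmetric and `B²` is an
expansive neighborhood for `f`. -/
theorem semiconj_unique {X : Type*} [TopologicalSpace X] (f g : X ≃ₜ X)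
    (B : Set (X × X)) (hBsymm : SymmRel B) (hB2 : IsExpansiveNbhd f (sq B))
    (h h' : X → X)
    (hh : ∀ x : X, (h x, x) ∈ B) (hh' : ∀ x : X, (h' x, x) ∈ B)
    (hc : ∀ x : X, f (h x) = h (g x)) (hc' : ∀ x : X, f (h' x) = h' (g x)) :
    h = h' := by
  funext x
  by_contra hne
  obtain ⟨n, hn⟩ := hB2.2.2 (h x) (h' x) hne
  rw [iter_apply_of_semiconj hc, iter_apply_of_semiconj hc'] at hn
  exact hn ⟨iter g n x, hh _, hBsymm _ (hh' _)⟩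
end
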